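/- Let n ≥ 1 and let γ ∈ U(n). For p, q ≥ 0 let χ̃_{p,q}(γ) denote the trace of the ℂ-linear action of γ on the finite-dimensional space 𝒫_{p,q}. Then for all complex numbers z, w with |z| < 1 and |w| < 1, the double series Σ_{p,q ≥ 0} χ̃_{p,q}(γ)·z^p·w^q converges absolutely and its sum equals 1 / ( det(z·I − γ) · det(w·I − γ̄) ), where γ̄ is the entrywise complex conjugate of γ. -/

import Mathlib

open MvPolynomial Matrix Complex

noncomputable section

/-- The polynomial ring `ℂ[z_1,…,z_n, z̄_1,…,z̄_n]`. -/
abbrev Rn (n : ℕ) := MvPolynomial (Fin n ⊕ Fin n) ℂ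

/-- Weight assigning `(1,0)` to each `z_j` and `(0,1)` to each `z̄_j`. -/
def wt (n : ℕ) : (Fin n ⊕ Fin n) → ℕ × ℕ := Sum.elim (fun _ => (1, 0)) (fun _ => (0, 1))

/-- `𝒫_{p,q}`: polynomials homogeneous of degree `p` in `z` and `q` in `z̄`. -/
def Ppq (n p q : ℕ) : Submodule ℂ (Rn n) :=
  MvPolynomial.weightedHomogeneousSubmodule ℂ (wt n) (p, q)

/-- The action of a matrix `γ` on `R_n` by the algebra substitution
`z_i ↦ Σ_j (γ⁻¹)_{ij} z_j`, `z̄_i ↦ Σ_j conj((γ⁻¹)_{ij}) z̄_j`. -/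
def matAct (n : ℕ) (γ : Matrix (Fin n) (Fin n) ℂ) : Rn n →ₐ[ℂ] Rn n :=
  MvPolynomial.aeval (Sum.elim
    (fun i => ∑ j, (γ⁻¹ i j) • MvPolynomial.X (Sum.inl j))
    (fun i => ∑ j, (starRingEnd ℂ) (γ⁻¹ i j) • MvPolynomial.X (Sum.inr j)))

/-- The projection of `R_n` onto the bihomogeneous component `𝒫_{p,q}`. -/
def projPpq (n p q : ℕ) : Rn n →ₗ[ℂ] Ppq n p q :=
  LinearMap.codRestrict (Ppq n p q)
    (MvPolynomial.weightedHomogeneousComponent (wt n) (p, q))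
    (fun φ => MvPolynomial.weightedHomogeneousComponent_mem (wt n) φ (p, q))

/-- `χ̃_{p,q}(γ)`: the trace of the action of `γ` on `𝒫_{p,q}` (the action preserves
`𝒫_{p,q}`, so composing with the canonical projection computes the trace of the induced
endomorphism of `𝒫_{p,q}`). -/
def chiP (n p q : ℕ) (γ : Matrix (Fin n) (Fin n) ℂ) : ℂ :=
  LinearMap.trace ℂ (Ppq n p q)
    ((projPpq n p q) ∘ₗ (matAct n γ).toLinearMap ∘ₗ (Ppq n p q).subtype)

/-- The geometric series in several variables, indexed by exponent functions on `Fin n`. -/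
theorem hasSum_prod_pow_fin (n : ℕ) (x : Fin n → ℂ) (hx : ∀ i, ‖x i‖ < 1) :
    Summable (fun d : Fin n → ℕ => ‖∏ i, x i ^ d i‖) ∧
      HasSum (fun d : Fin n → ℕ => ∏ i, x i ^ d i) (∏ i, (1 - x i)⁻¹) := by
  induction n with
  | zero => exact ⟨(hasSum_unique _).summable, by simp⟩
  | succ n ih =>
    obtain ⟨hs, hsum⟩ := ih (fun i => x i.succ) (fun i => hx i.succ)
    have hgeom : Summable fun k : ℕ => ‖x 0 ^ k‖ := by
      simpa using summable_geometric_of_lt_one (norm_nonneg _) (hx 0)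
    have hnorm := hgeom.mul_norm hs
    let e : ℕ × (Fin n → ℕ) ≃ (Fin (n + 1) → ℕ) := Fin.consEquiv fun _ => ℕ
    have he : (fun d : Fin (n + 1) → ℕ => ∏ i, x i ^ d i) ∘ e =
        fun p : ℕ × (Fin n → ℕ) => x 0 ^ p.1 * ∏ i, x i.succ ^ p.2 i := by
      funext p
      simp [e, Fin.prod_univ_succ]
    constructor
    · rw [← e.summable_iff]
      convert hnorm using 1
      funext p
      exact congrArg norm (congrFun he p)
    · rw [← e.hasSum_iff, he, Fin.prod_univ_succ]
      have hsummable : Summable fun p : ℕ × (Fin n → ℕ) => x 0 ^ p.1 * ∏ i, x i.succ ^ p.2 i :=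
        hnorm.of_norm
      exact HasSum.mul (f := fun k => x 0 ^ k) (g := fun d : Fin n → ℕ => ∏ i, x i.succ ^ d i)
        (hasSum_geometric_of_norm_lt_one (hx 0)) hsum hsummable

/-- The geometric series in finitely many variables, indexed by monomial exponents. -/
theorem hasSum_prod_pow_finsupp {ι : Type*} [Fintype ι] (x : ι → ℂ) (hx : ∀ i, ‖x i‖ < 1) :
    Summable (fun d : ι →₀ ℕ => ‖∏ i, x i ^ d i‖) ∧
      HasSum (fun d : ι →₀ ℕ => ∏ i, x i ^ d i) (∏ i, (1 - x i)⁻¹) := by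
  let f := Fintype.equivFin ι
  obtain ⟨hs, hsum⟩ := hasSum_prod_pow_fin _ (x ∘ f.symm) fun i => hx _
  let e : (ι →₀ ℕ) ≃ (Fin (Fintype.card ι) → ℕ) :=
    Finsupp.equivFunOnFinite.trans (f.arrowCongr (Equiv.refl ℕ))
  have he : (fun d : Fin (Fintype.card ι) → ℕ => ∏ i, (x ∘ f.symm) i ^ d i) ∘ e =
      fun d : ι →₀ ℕ => ∏ i, x i ^ d i := by
    funext d
    simp only [Function.comp_apply, e, Equiv.trans_apply, Equiv.arrowCongr_apply, Equiv.refl_apply]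
    exact f.symm.prod_comp fun i => x i ^ d i
  constructor
  · rw [← e.summable_iff] at hs
    convert hs using 1
    funext d
    exact congrArg norm (congrFun he d).symm
  · rw [← e.hasSum_iff, he] at hsum
    convert hsum using 1
    exact (f.symm.prod_comp fun i => (1 - x i)⁻¹).symm

open scoped ComplexOrder in
/-- A unitary matrix is diagonalizable, with eigenvalues on the unit circle. -/
theorem exists_diagonalization_of_mem_unitaryGroup {n : ℕ} {U : Matrix (Fin n) (Fin n) ℂ}
    (hU : U ∈ Matrix.unitaryGroup (Fin n) ℂ) :
    ∃ (P Q : Matrix (Fin n) (Fin n) ℂ) (l : Fin n → ℂ),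
      P * Q = 1 ∧ U = P * Matrix.diagonal l * Q ∧ ∀ i, ‖l i‖ = 1 := by
  have h1 : Uᴴ * U = 1 := Matrix.mem_unitaryGroup_iff'.mp hU
  have h2 : U * Uᴴ = 1 := Matrix.mem_unitaryGroup_iff.mp hU
  have hA : (U + Uᴴ).IsHermitian := by
    simp [Matrix.IsHermitian, add_comm]
  have hB : (Complex.I • (U - Uᴴ)).IsHermitian := by
    simp [Matrix.IsHermitian, Matrix.conjTranspose_smul, ← smul_neg]
  have hAB : Commute (U + Uᴴ).toEuclideanLin (Complex.I • (U - Uᴴ)).toEuclideanLin := by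
    have : (U + Uᴴ) * (Complex.I • (U - Uᴴ)) = (Complex.I • (U - Uᴴ)) * (U + Uᴴ) := by
      simp only [mul_smul_comm, smul_mul_assoc]
      congr 1
      simp only [add_mul, mul_sub, sub_mul, mul_add, h1, h2]
      abel
    refine LinearMap.ext fun v => ?_
    rw [Module.End.mul_apply, Module.End.mul_apply]
    simp only [Matrix.toLpLin_apply]
    rw [Matrix.mulVec_mulVec, this, Matrix.mulVec_mulVec]
  have h_internal := LinearMap.IsSymmetric.directSum_isInternal_of_commute
    (Matrix.isSymmetric_toEuclideanLin_iff.mpr hA) (Matrix.isSymmetric_toEuclideanLin_iff.mpr hB) hAB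
  let b₀ := h_internal.collectedBasis fun i => Module.finBasis ℂ _
  have := Module.Finite.finite_basis b₀
  have := Fintype.ofFinite
    (Σ i : ℂ × ℂ, Fin (Module.finrank ℂ ↥(Module.End.eigenspace (U + Uᴴ).toEuclideanLin i.2 ⊓
      Module.End.eigenspace (Complex.I • (U - Uᴴ)).toEuclideanLin i.1)))
  have e := Fintype.equivFinOfCardEq
    ((Module.finrank_eq_card_basis b₀).symm.trans finrank_euclideanSpace_fin)
  let b := (b₀.reindex e).map (WithLp.linearEquiv 2 ℂ (Fin n → ℂ))
  have hb : ∀ i, ∃ μ : ℂ, U *ᵥ b i = μ • b i := by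
    intro i
    have hmem := h_internal.collectedBasis_mem (fun i => Module.finBasis ℂ _) (e.symm i)
    obtain ⟨ha, hb⟩ := Submodule.mem_inf.mp hmem
    have hbi : b i = WithLp.linearEquiv 2 ℂ (Fin n → ℂ) (b₀ (e.symm i)) := by simp [b]
    have ha' : (U + Uᴴ) *ᵥ b i = (e.symm i).1.2 • b i := by
      rw [hbi]
      exact congrArg (WithLp.linearEquiv 2 ℂ (Fin n → ℂ)) (Module.End.mem_eigenspace_iff.mp ha)
    have hb' : (Complex.I • (U - Uᴴ)) *ᵥ b i = (e.symm i).1.1 • b i := by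
      rw [hbi]
      exact congrArg (WithLp.linearEquiv 2 ℂ (Fin n → ℂ)) (Module.End.mem_eigenspace_iff.mp hb)
    rw [Matrix.add_mulVec] at ha'
    rw [Matrix.smul_mulVec, Matrix.sub_mulVec] at hb'
    refine ⟨((e.symm i).1.2 - Complex.I * (e.symm i).1.1) / 2, ?_⟩
    ext k
    have hak := congrFun ha' k
    have hbk := congrFun hb' k
    simp only [Pi.add_apply, Pi.sub_apply, Pi.smul_apply, smul_eq_mul] at hak hbk ⊢
    linear_combination (1 / 2) * hak - (Complex.I / 2) * hbk +
      ((U *ᵥ b i) k - (Uᴴ *ᵥ b i) k) / 2 * Complex.I_mul_I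
  choose l hl using hb
  let P : Matrix (Fin n) (Fin n) ℂ := (Pi.basisFun ℂ (Fin n)).toMatrix b
  let Q : Matrix (Fin n) (Fin n) ℂ := b.toMatrix (Pi.basisFun ℂ (Fin n))
  have hPQ : P * Q = 1 := Module.Basis.toMatrix_mul_toMatrix_flip _ _
  have hUP : U * P = P * Matrix.diagonal l := by
    ext i j
    rw [Matrix.mul_diagonal, mul_comm]
    exact congrFun (hl j) i
  refine ⟨P, Q, l, hPQ, by rw [← hUP, mul_assoc, hPQ, mul_one], fun i => ?_⟩
  have hne : star (b i) ⬝ᵥ b i ≠ 0 :=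
    fun h => b.ne_zero i (dotProduct_star_self_eq_zero.mp h)
  have hiso : star (U *ᵥ b i) ⬝ᵥ (U *ᵥ b i) = star (b i) ⬝ᵥ b i := by
    rw [Matrix.star_mulVec, Matrix.dotProduct_mulVec, Matrix.vecMul_vecMul, h1, Matrix.vecMul_one]
  rw [hl, star_smul, smul_dotProduct, dotProduct_smul, smul_smul, smul_eq_mul] at hiso
  have hsq : star (l i) * l i = 1 := mul_right_cancel₀ hne (by rw [hiso, one_mul])
  exact CStarRing.norm_of_mem_unitary (Unitary.mem_iff.mpr ⟨hsq, by rwa [mul_comm]⟩)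

section LinearSubstitution

variable {σ : Type*} [Fintype σ]

/-- The substitution `X i ↦ ∑ j, A i j • X j`. -/
def linSubst (A : Matrix σ σ ℂ) : MvPolynomial σ ℂ →ₐ[ℂ] MvPolynomial σ ℂ :=
  MvPolynomial.aeval fun i => ∑ j, A i j • MvPolynomial.X j

theorem linSubst_comp (A B : Matrix σ σ ℂ) :
    (linSubst A).comp (linSubst B) = linSubst (B * A) := by
  refine MvPolynomial.algHom_ext fun i => ?_
  simp only [linSubst, AlgHom.comp_apply, aeval_X, map_sum, map_smul, Finset.smul_sum,
    Matrix.mul_apply, Finset.sum_smul, smul_smul]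
  exact Finset.sum_comm

theorem linSubst_one [DecidableEq σ] : linSubst (1 : Matrix σ σ ℂ) = AlgHom.id ℂ _ := by
  refine MvPolynomial.algHom_ext fun i => ?_
  simp [linSubst, Matrix.one_apply]

theorem linSubst_diagonal_monomial [DecidableEq σ] (l : σ → ℂ) (d : σ →₀ ℕ) (r : ℂ) :
    linSubst (Matrix.diagonal l) (monomial d r) = (∏ i, l i ^ d i) • monomial d r := by
  simp only [linSubst, Matrix.diagonal_apply, ite_smul, zero_smul, Finset.sum_ite_eq,
    Finset.mem_univ, if_true]
  rw [MvPolynomial.aeval_monomial, Finsupp.prod_fintype _ _ (by simp)]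
  simp only [_root_.smul_pow]
  rw [Finset.prod_smul, monomial_eq, Finsupp.prod_fintype _ _ (by simp)]
  simp [algebraMap_eq]

variable {M : Type*} [AddCommMonoid M] {w : σ → M}

theorem linSubst_mem_weightedHomogeneousSubmodule {A : Matrix σ σ ℂ}
    (hA : ∀ i j, A i j ≠ 0 → w j = w i) (m : M) :
    ∀ φ ∈ weightedHomogeneousSubmodule ℂ w m,
      (linSubst A).toLinearMap φ ∈ weightedHomogeneousSubmodule ℂ w m := by
  intro φ hφ
  rw [AlgHom.toLinearMap_apply]
  refine IsWeightedHomogeneous.induction_on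
    (motive := fun p _ => linSubst A p ∈ weightedHomogeneousSubmodule ℂ w m) ?_ ?_ ?_ hφ
  · simp
  · intro p q _ _ hp hq
    rw [map_add]
    exact add_mem hp hq
  · rintro d r rfl
    rw [linSubst, aeval_monomial, Finsupp.prod_fintype _ _ (by simp)]
    refine IsWeightedHomogeneous.C_mul ?_ r
    rw [Finsupp.weight_eq_sum]
    refine IsWeightedHomogeneous.prod _ _ _ fun i _ => IsWeightedHomogeneous.pow ?_ _
    refine IsWeightedHomogeneous.sum _ _ _ fun j _ => ?_
    by_cases h : A i j = 0
    · simpa [h] using isWeightedHomogeneous_zero ℂ w (w i)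
    · rw [smul_eq_C_mul, ← hA i j h]
      exact (isWeightedHomogeneous_X ℂ w j).C_mul _

/-- The trace of a diagonal substitution on a weighted homogeneous component is the sum over the
monomials in that component. -/
theorem trace_restrict_linSubst_diagonal [DecidableEq σ] (l : σ → ℂ) (m : M)
    [Fintype {d : σ →₀ ℕ // Finsupp.weight w d = m}]
    (h : ∀ φ ∈ weightedHomogeneousSubmodule ℂ w m,
      (linSubst (Matrix.diagonal l)).toLinearMap φ ∈ weightedHomogeneousSubmodule ℂ w m) :
    LinearMap.trace ℂ _ ((linSubst (Matrix.diagonal l)).toLinearMap.restrict h) =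
      ∑ d : {d : σ →₀ ℕ // Finsupp.weight w d = m}, ∏ i, l i ^ d.1 i := by
  let b : Module.Basis {d : σ →₀ ℕ // Finsupp.weight w d = m} ℂ
      (weightedHomogeneousSubmodule ℂ w m) :=
    (basisRestrictSupport ℂ {d : σ →₀ ℕ | Finsupp.weight w d = m}).map
      (LinearEquiv.ofEq _ _ (weightedHomogeneousSubmodule_eq_finsupp_supported ℂ w m).symm)
  have hb : ∀ d, (b d : MvPolynomial σ ℂ) = monomial d.1 1 := by
    intro d
    have hd := isWeightedHomogeneous_monomial w d.1 (1 : ℂ) d.2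
    refine congrArg Subtype.val (b.apply_eq_iff.mpr (?_ : b.repr ⟨monomial d.1 1, hd⟩ = _))
    ext d'
    have hrepr : b.repr ⟨monomial d.1 1, hd⟩ d' = coeff d'.1 (monomial d.1 (1 : ℂ)) := rfl
    rw [hrepr, coeff_monomial, Finsupp.single_apply]
    simp only [Subtype.ext_iff]
  rw [LinearMap.trace_eq_matrix_trace ℂ b, Matrix.trace]
  refine Finset.sum_congr rfl fun d _ => ?_
  have hd : (linSubst (Matrix.diagonal l)).toLinearMap.restrict h (b d) =
      (∏ i, l i ^ d.1 i) • b d := by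
    ext1
    rw [LinearMap.coe_restrict_apply, Submodule.coe_smul, hb, AlgHom.toLinearMap_apply,
      linSubst_diagonal_monomial]
  rw [Matrix.diag_apply, LinearMap.toMatrix_apply, hd]
  simp

/-- Conjugate matrices have the same trace on each weighted homogeneous component. -/
theorem trace_restrict_linSubst_conj [DecidableEq σ] {P D Q : Matrix σ σ ℂ} (hPQ : P * Q = 1)
    (hP : ∀ i j, P i j ≠ 0 → w j = w i) (hD : ∀ i j, D i j ≠ 0 → w j = w i)
    (hQ : ∀ i j, Q i j ≠ 0 → w j = w i) (m : M)
    (h : ∀ φ ∈ weightedHomogeneousSubmodule ℂ w m,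
      (linSubst (P * D * Q)).toLinearMap φ ∈ weightedHomogeneousSubmodule ℂ w m) :
    LinearMap.trace ℂ _ ((linSubst (P * D * Q)).toLinearMap.restrict h) =
      LinearMap.trace ℂ _ ((linSubst D).toLinearMap.restrict
        (linSubst_mem_weightedHomogeneousSubmodule hD m)) := by
  let p := (linSubst P).toLinearMap.restrict (linSubst_mem_weightedHomogeneousSubmodule hP m)
  let d := (linSubst D).toLinearMap.restrict (linSubst_mem_weightedHomogeneousSubmodule hD m)
  let q := (linSubst Q).toLinearMap.restrict (linSubst_mem_weightedHomogeneousSubmodule hQ m)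
  have h1 : (linSubst (P * D * Q)).toLinearMap.restrict h = q * d * p := by
    ext φ : 2
    simp [p, d, q, ← linSubst_comp]
  have h2 : p * q = 1 := by
    have : (linSubst P).comp (linSubst Q) = AlgHom.id ℂ _ := by
      rw [linSubst_comp, mul_eq_one_comm.mp hPQ, linSubst_one]
    ext φ : 2
    simpa [p, q] using DFunLike.congr_fun this φ.1
  rw [h1, LinearMap.trace_mul_cycle, h2, one_mul]

end LinearSubstitution

/-- Summing an absolutely convergent series along the finite fibres of a map. -/
theorem hasSum_sum_fiber {α β : Type*} (g : α → β) [∀ b, Fintype {x // g x = b}] {f : α → ℂ}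
    {a : ℂ} (hs : Summable fun x => ‖f x‖) (hf : HasSum f a) :
    (Summable fun b => ‖∑ x : {x // g x = b}, f x‖) ∧
      HasSum (fun b => ∑ x : {x // g x = b}, f x) a := by
  constructor
  · have h := ((Equiv.sigmaFiberEquiv g).summable_iff.mpr hs).sigma
    refine h.of_nonneg_of_le (fun _ => norm_nonneg _) fun b => ?_
    rw [tsum_fintype]
    exact norm_sum_le _ _
  · exact ((Equiv.sigmaFiberEquiv g).hasSum_iff.mpr hf).sigma fun b => hasSum_fintype _

theorem weight_wt {n : ℕ} (d : Fin n ⊕ Fin n →₀ ℕ) :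
    Finsupp.weight (wt n) d = (∑ i, d (Sum.inl i), ∑ i, d (Sum.inr i)) := by
  simp [Finsupp.weight_eq_sum, wt, Fintype.sum_sum_type, Prod.ext_iff, Prod.fst_sum, Prod.snd_sum]

theorem finite_weight_wt_eq (n : ℕ) (pq : ℕ × ℕ) :
    Finite {d : Fin n ⊕ Fin n →₀ ℕ // Finsupp.weight (wt n) d = pq} := by
  refine (Set.Finite.subset (Finsupp.finite_of_nat_weight_eq (fun _ => 1)
    (fun _ => one_ne_zero) (pq.1 + pq.2)) ?_).to_subtype
  rintro d rfl
  rw [Set.mem_ofPred_eq, weight_wt, Finsupp.weight_eq_sum]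
  simp [Fintype.sum_sum_type]

theorem matAct_eq_linSubst {n : ℕ} (γ : Matrix (Fin n) (Fin n) ℂ) :
    matAct n γ = linSubst (Matrix.fromBlocks γ⁻¹ 0 0 (γ⁻¹.map (starRingEnd ℂ))) := by
  refine MvPolynomial.algHom_ext fun i => ?_
  cases i <;> simp [matAct, linSubst, Fintype.sum_sum_type]

theorem wt_eq_of_fromBlocks_ne_zero {n : ℕ} (A B : Matrix (Fin n) (Fin n) ℂ) :
    ∀ i j, Matrix.fromBlocks A 0 0 B i j ≠ 0 → wt n j = wt n i := by
  rintro (i | i) (j | j) <;> simp [wt]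

/-- If `γ⁻¹` has eigenvalues `l`, then `χ̃_{p,q}(γ)` is the sum of the corresponding products over
all monomials of bidegree `(p, q)`. -/
theorem chiP_eq_sum {n : ℕ} (pq : ℕ × ℕ)
    [Fintype {d : Fin n ⊕ Fin n →₀ ℕ // Finsupp.weight (wt n) d = pq}]
    {γ P Q : Matrix (Fin n) (Fin n) ℂ} {l : Fin n → ℂ} (hPQ : P * Q = 1)
    (hγ : γ⁻¹ = P * Matrix.diagonal l * Q) :
    chiP n pq.1 pq.2 γ = ∑ d : {d : Fin n ⊕ Fin n →₀ ℕ // Finsupp.weight (wt n) d = pq},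
      ∏ i, Sum.elim l (fun i => starRingEnd ℂ (l i)) i ^ d.1 i := by
  let c := starRingEnd ℂ
  let D := Matrix.diagonal (Sum.elim l fun i => c (l i))
  have hDblocks : D = Matrix.fromBlocks (Matrix.diagonal l) 0 0 (Matrix.diagonal fun i => c (l i)) :=
    (Matrix.fromBlocks_diagonal _ _).symm
  have hmap : matAct n γ = linSubst
      (Matrix.fromBlocks P 0 0 (P.map c) * D * Matrix.fromBlocks Q 0 0 (Q.map c)) := by
    rw [matAct_eq_linSubst, hDblocks, hγ, Matrix.fromBlocks_multiply, Matrix.fromBlocks_multiply]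
    simp [Matrix.map_mul, Matrix.diagonal_map, c]
  have hone : Matrix.fromBlocks P 0 0 (P.map c) * Matrix.fromBlocks Q 0 0 (Q.map c) = 1 := by
    simp [Matrix.fromBlocks_multiply, ← Matrix.map_mul, hPQ]
  have hD : ∀ i j, D i j ≠ 0 → wt n j = wt n i := by
    rw [hDblocks]
    exact wt_eq_of_fromBlocks_ne_zero _ _
  have hmem : ∀ φ ∈ weightedHomogeneousSubmodule ℂ (wt n) pq, (linSubst (Matrix.fromBlocks P 0 0
      (P.map c) * D * Matrix.fromBlocks Q 0 0 (Q.map c))).toLinearMap φ ∈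
        weightedHomogeneousSubmodule ℂ (wt n) pq := by
    rw [← hmap, matAct_eq_linSubst]
    exact linSubst_mem_weightedHomogeneousSubmodule (wt_eq_of_fromBlocks_ne_zero _ _) pq
  rw [← trace_restrict_linSubst_diagonal _ pq (linSubst_mem_weightedHomogeneousSubmodule hD pq),
    ← trace_restrict_linSubst_conj hone (wt_eq_of_fromBlocks_ne_zero _ _) hD
      (wt_eq_of_fromBlocks_ne_zero _ _) pq hmem]
  unfold chiP
  congr 1
  refine LinearMap.ext fun φ => Subtype.ext ?_
  have hφ := hmem φ.1 φ.2
  rw [← hmap] at hφ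
  refine (weightedHomogeneousComponent_eq_self hφ).trans ?_
  rw [hmap]
  rfl

theorem det_smul_one_sub_of_unitary {n : ℕ} {γ P Q : Matrix (Fin n) (Fin n) ℂ} {l : Fin n → ℂ}
    (hγ : γ * (P * Matrix.diagonal l * Q) = 1) (hPQ : P * Q = 1) (z : ℂ) :
    (z • (1 : Matrix (Fin n) (Fin n) ℂ) - γ).det = (-1) ^ n * γ.det * ∏ i, (1 - l i * z) := by
  have h1 : z • (1 : Matrix (Fin n) (Fin n) ℂ) - γ =
      -(γ * (P * Matrix.diagonal (fun i => 1 - l i * z) * Q)) := by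
    have hdiag : Matrix.diagonal (fun i => 1 - l i * z) = 1 - z • Matrix.diagonal l := by
      ext i j
      by_cases h : i = j <;> simp [h, mul_comm]
    rw [hdiag, mul_sub, sub_mul, mul_one, hPQ, mul_sub, mul_one, mul_smul_comm, smul_mul_assoc,
      mul_smul_comm, hγ, neg_sub]
  have h2 : P.det * Q.det = 1 := by rw [← Matrix.det_mul, hPQ, Matrix.det_one]
  rw [h1, Matrix.det_neg, Matrix.det_mul, Matrix.det_mul, Matrix.det_mul, Matrix.det_diagonal,
    Fintype.card_fin]
  linear_combination (-1) ^ n * γ.det * (∏ i, (1 - l i * z)) * h2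

/-- **The character generating function of a unitary matrix.**
For `γ ∈ U(n)` and `|z|, |w| < 1`, the double series `Σ_{p,q} χ̃_{p,q}(γ) z^p w^q`
converges absolutely and equals `1 / (det(zI - γ)·det(wI - γ̄))`. -/
theorem character_generating_function (n : ℕ) (hn : 1 ≤ n)
    (γ : Matrix.unitaryGroup (Fin n) ℂ) (z w : ℂ) (hz : ‖z‖ < 1) (hw : ‖w‖ < 1) :
    Summable (fun pq : ℕ × ℕ =>
      ‖chiP n pq.1 pq.2 (↑γ : Matrix (Fin n) (Fin n) ℂ) * z ^ pq.1 * w ^ pq.2‖) ∧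
    HasSum (fun pq : ℕ × ℕ =>
        chiP n pq.1 pq.2 (↑γ : Matrix (Fin n) (Fin n) ℂ) * z ^ pq.1 * w ^ pq.2)
      (1 / (Matrix.det (z • (1 : Matrix (Fin n) (Fin n) ℂ) - (↑γ : Matrix (Fin n) (Fin n) ℂ)) *
        Matrix.det (w • (1 : Matrix (Fin n) (Fin n) ℂ) -
          ((↑γ : Matrix (Fin n) (Fin n) ℂ)).map (starRingEnd ℂ)))) := by
  let c := starRingEnd ℂ
  obtain ⟨P, Q, l, hPQ, hU, hl⟩ := exists_diagonalization_of_mem_unitaryGroup (star γ).2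
  have hγU : γ.1 * star γ.1 = 1 := Matrix.mem_unitaryGroup_iff.mp γ.2
  have hmul : γ.1 * (P * Matrix.diagonal l * Q) = 1 := by
    rw [← hU]
    exact hγU
  have hinv : γ.1⁻¹ = P * Matrix.diagonal l * Q := Matrix.inv_eq_right_inv hmul
  have hmulc : γ.1.map c * (P.map c * Matrix.diagonal (fun i => c (l i)) * Q.map c) = 1 := by
    have h := congrArg (fun A => A.map c) hmul
    simpa [Matrix.map_mul, Matrix.diagonal_map] using h
  have hPQc : P.map c * Q.map c = 1 := by
    rw [← Matrix.map_mul, hPQ]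
    simp
  have hdet : γ.1.det * (γ.1.map c).det = 1 := by
    have h : (γ.1.map c).det = (star γ.1).det := by
      rw [← Matrix.det_transpose (star γ.1)]
      rfl
    rw [h, ← Matrix.det_mul, hγU, Matrix.det_one]
  let x : Fin n ⊕ Fin n → ℂ := Sum.elim (fun i => l i * z) fun i => c (l i) * w
  have hx : ∀ i, ‖x i‖ < 1 := by
    rintro (i | i) <;> simpa [x, c, hl]
  have := finite_weight_wt_eq n
  have := fun pq => Fintype.ofFinite {d : Fin n ⊕ Fin n →₀ ℕ // Finsupp.weight (wt n) d = pq}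
  obtain ⟨hs, hsum⟩ := hasSum_prod_pow_finsupp x hx
  have hterm : ∀ pq : ℕ × ℕ, chiP n pq.1 pq.2 γ.1 * z ^ pq.1 * w ^ pq.2 =
      ∑ d : {d : Fin n ⊕ Fin n →₀ ℕ // Finsupp.weight (wt n) d = pq}, ∏ i, x i ^ d.1 i := by
    intro pq
    rw [chiP_eq_sum pq hPQ hinv, Finset.sum_mul, Finset.sum_mul]
    refine Finset.sum_congr rfl ?_
    rintro ⟨d, rfl⟩ -
    simp only [weight_wt, x, Fintype.prod_sum_type, Sum.elim_inl, Sum.elim_inr, _root_.mul_pow,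
      Finset.prod_mul_distrib, Finset.prod_pow_eq_pow_sum, c]
    ring
  have hval : 1 / ((z • (1 : Matrix (Fin n) (Fin n) ℂ) - γ.1).det *
      (w • (1 : Matrix (Fin n) (Fin n) ℂ) - γ.1.map c).det) = ∏ i, (1 - x i)⁻¹ := by
    rw [det_smul_one_sub_of_unitary hmul hPQ, det_smul_one_sub_of_unitary hmulc hPQc, one_div,
      Finset.prod_inv_distrib, Fintype.prod_sum_type]
    congr 1
    have hsign : ((-1 : ℂ) ^ n) * (-1) ^ n = 1 := by rw [← _root_.mul_pow]; simp
    simp only [x, Sum.elim_inl, Sum.elim_inr]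
    linear_combination (∏ i, (1 - l i * z)) * (∏ i, (1 - c (l i) * w)) *
      (hdet * ((-1) ^ n * (-1) ^ n) + hsign)
  simp only [hterm]
  rw [hval]
  exact hasSum_sum_fiber (f := fun d : Fin n ⊕ Fin n →₀ ℕ => ∏ i, x i ^ d i) _ hs hsum

end
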